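/- Let $\rho$ be a probability measure on $\mathcal{Z} = \mathcal{X} \times \mathcal{Y}$ with $\mathcal{X} \subseteq \mathbb{R}^D$, let $K(x_1, x_2) = \phi(|x_1 - x_2|)$ be a radial kernel, let $A \in \mathbb{R}^{d \times D}$ have orthonormal rows with inverse $A_{\rm inv}$ having orthonormal columns on $\operatorname{supp}(\rho_X)$, and let $\tilde{\rho}$ be the law of $(AX, Y)$ for $(X, Y) \sim \rho$. Then for every $\lambda > 0$, the regularized approximation errors coincide: $\int (f_{\lambda, \rho}(x) - f_\rho(x))^2 \, \rho_X(dx) = \int (f_{\lambda, \tilde{\rho}}(\tilde{x}) - f_{\tilde{\rho}}(\tilde{x}))^2 \, \tilde{\rho}_{\tilde{X}}(d\tilde{x})$. In particular, the approximation parameter $\beta$ (satisfying $\|f_{\lambda,\rho} - f_\rho\|^2_{L^2(\rho_X)} + \lambda\|f_{\lambda,\rho}\|_{\mathcal{H}}^2 \leq C \lambda^\beta$) can be chosen equally for the learning problems with $\rho$ and $\tilde{\rho}$. -/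

import Mathlib

open MeasureTheory
open scoped RealInnerProductSpace ENNReal

/-- The (topological) support of a measure. -/
def measureSupport {X : Type*} [TopologicalSpace X] [MeasurableSpace X]
    (μ : Measure X) : Set X :=
  {x | ∀ U ∈ nhds x, μ U ≠ 0}

section aux
open ProbabilityTheory

theorem aux_isometry {E H K : Type*}
    [NormedAddCommGroup H] [InnerProductSpace ℝ H] [CompleteSpace H]
    [NormedAddCommGroup K] [InnerProductSpace ℝ K] [CompleteSpace K]
    (k : E → H) (l : E → K) (h : ∀ u v, ⟪k u, k v⟫ = ⟪l u, l v⟫)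
    (hd : (Submodule.span ℝ (Set.range k)).topologicalClosure = ⊤) :
    ∃ J : H →ₗᵢ[ℝ] K, ∀ u, J (k u) = l u := by
  set e := Finsupp.linearCombination ℝ k with he
  set f := Finsupp.linearCombination ℝ l with hf
  have hdense : DenseRange e := by
    have : Dense ((Submodule.span ℝ (Set.range k) : Submodule ℝ H) : Set H) :=
      (Submodule.dense_iff_topologicalClosure_eq_top).2 hd
    rw [← Finsupp.range_linearCombination] at this
    rw [LinearMap.coe_range] at this
    exact this
  have hn : ∀ c, ‖f c‖ = ‖e c‖ := by
    intro c
    have : ⟪f c, f c⟫ = ⟪e c, e c⟫ := by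
      simp only [he, hf, Finsupp.linearCombination_apply, Finsupp.sum, sum_inner, inner_sum,
        inner_smul_left, inner_smul_right, h]
    rw [real_inner_self_eq_norm_sq, real_inner_self_eq_norm_sq] at this
    exact (sq_eq_sq₀ (norm_nonneg _) (norm_nonneg _)).1 this
  have hJ : ∀ c, f.extendOfNorm e (e c) = f c :=
    LinearMap.extendOfNorm_eq hdense ⟨1, fun c => by rw [hn, one_mul]⟩
  refine ⟨⟨(f.extendOfNorm e).toLinearMap, ?_⟩, ?_⟩
  · intro x
    refine hdense.induction_on (p := fun x => ‖f.extendOfNorm e x‖ = ‖x‖) x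
      (isClosed_eq (by fun_prop) (by fun_prop)) ?_
    intro c
    rw [hJ, hn]
  · intro u
    have := hJ (Finsupp.single u 1)
    simpa [he, hf] using this

theorem aux_unique {X H : Type*} [MeasurableSpace X]
    [NormedAddCommGroup H] [InnerProductSpace ℝ H]
    (ν : Measure (X × ℝ)) (k : X → H) (hy : Integrable (fun z => z.2 ^ 2) ν)
    (lam : ℝ) (hl : 0 < lam) (f g : H)
    (hf : ∀ h : H, (∫ z, (⟪f, k z.1⟫ - z.2) ^ 2 ∂ν) + lam * ‖f‖ ^ 2 ≤
      (∫ z, (⟪h, k z.1⟫ - z.2) ^ 2 ∂ν) + lam * ‖h‖ ^ 2)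
    (hg : ∀ h : H, (∫ z, (⟪g, k z.1⟫ - z.2) ^ 2 ∂ν) + lam * ‖g‖ ^ 2 ≤
      (∫ z, (⟪h, k z.1⟫ - z.2) ^ 2 ∂ν) + lam * ‖h‖ ^ 2) : f = g := by
  have hL : ∀ h : H, 0 ≤ ∫ z, (⟪h, k z.1⟫ - z.2) ^ 2 ∂ν :=
    fun h => integral_nonneg fun z => sq_nonneg _
  set m := (∫ z, (⟪f, k z.1⟫ - z.2) ^ 2 ∂ν) + lam * ‖f‖ ^ 2 with hm
  rcases le_or_gt m 0 with hm0 | hm0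
  · have h1 : f = 0 := by
      have h2 : lam * ‖f‖ ^ 2 ≤ 0 := by linarith [hL f]
      have h3 : ‖f‖ ^ 2 ≤ 0 := by nlinarith
      have : ‖f‖ = 0 := by nlinarith [norm_nonneg f]
      simpa using this
    have h2 : g = 0 := by
      have h2 : lam * ‖g‖ ^ 2 ≤ 0 := by linarith [hL g, hg f]
      have h3 : ‖g‖ ^ 2 ≤ 0 := by nlinarith
      have : ‖g‖ = 0 := by nlinarith [norm_nonneg g]
      simpa using this
    rw [h1, h2]
  · have hint : ∀ h : H, Integrable (fun z => (⟪h, k z.1⟫ - z.2) ^ 2) ν := by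
      intro h
      have key : ∀ t : ℝ, lam * (t ^ 2 * ‖h‖ ^ 2) < m →
          Integrable (fun z => (t * ⟪h, k z.1⟫ - z.2) ^ 2) ν := by
        intro t ht
        by_contra hc
        have h1 := hf (t • h)
        simp only [inner_smul_left, norm_smul, mul_pow, Real.norm_eq_abs, sq_abs] at h1
        have h2 : ∫ z, (t * ⟪h, k z.1⟫ - z.2) ^ 2 ∂ν = 0 := integral_undef hc
        simp only [RCLike.conj_to_real] at h1
        rw [h2] at h1
        linarith
      have hpos : 0 < lam * (‖h‖ ^ 2 + 1) := by positivity
      set t := Real.sqrt (m / (lam * (‖h‖ ^ 2 + 1))) with ht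
      have ht0 : 0 < t := Real.sqrt_pos.2 (by positivity)
      have ht2 : t ^ 2 * (lam * (‖h‖ ^ 2 + 1)) = m := by
        rw [ht, Real.sq_sqrt (by positivity)]
        field_simp
      have hp : 0 < t ^ 2 * lam := by positivity
      have hq : 0 ≤ t ^ 2 * lam * ‖h‖ ^ 2 := by positivity
      have i1 := key t (by nlinarith)
      have i2 := key (t / 2) (by nlinarith)
      -- t² h² - 2 t h y,  t²/4 h² - t h y
      have j1 := i1.sub hy
      have j2 := i2.sub hy
      have a1 : Integrable (fun z : X × ℝ => ⟪h, k z.1⟫ ^ 2) ν := by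
        refine ((j1.sub (j2.const_mul 2)).const_mul (2 / t ^ 2)).congr (Filter.Eventually.of_forall ?_)
        intro z
        simp only [Pi.sub_apply]
        field_simp
        ring
      have a2 : Integrable (fun z : X × ℝ => ⟪h, k z.1⟫ * z.2) ν := by
        refine ((j1.sub (a1.const_mul (t ^ 2))).const_mul (-1 / (2 * t))).congr
          (Filter.Eventually.of_forall ?_)
        intro z
        simp only [Pi.sub_apply]
        field_simp
        ring
      refine ((a1.sub (a2.const_mul 2)).add hy).congr (Filter.Eventually.of_forall ?_)
      intro z
      simp only [Pi.sub_apply, Pi.add_apply]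
      ring
    have hmid : ∫ z, (⟪(1 / 2 : ℝ) • (f + g), k z.1⟫ - z.2) ^ 2 ∂ν ≤
        (1 / 2) * (∫ z, (⟪f, k z.1⟫ - z.2) ^ 2 ∂ν) + (1 / 2) * ∫ z, (⟪g, k z.1⟫ - z.2) ^ 2 ∂ν := by
      rw [← integral_const_mul, ← integral_const_mul,
        ← integral_add ((hint f).const_mul _) ((hint g).const_mul _)]
      refine integral_mono (hint _) (((hint f).const_mul _).add ((hint g).const_mul _)) ?_
      intro z
      simp only [inner_smul_left, inner_add_left, RCLike.conj_to_real]
      nlinarith [sq_nonneg (⟪f, k z.1⟫ - ⟪g, k z.1⟫)]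
    have h1 := hf ((1 / 2 : ℝ) • (f + g))
    have h2 := hg ((1 / 2 : ℝ) • (f + g))
    have hn : ‖(1 / 2 : ℝ) • (f + g)‖ ^ 2 = 1 / 4 * ‖f + g‖ ^ 2 := by
      rw [norm_smul, mul_pow]; norm_num
    have hp := parallelogram_law_with_norm ℝ f g
    rw [hn] at h1 h2
    have h3 : lam * (‖f - g‖ * ‖f - g‖) ≤ 0 := by
      have : ‖f - g‖ * ‖f - g‖ = 2 * (‖f‖ * ‖f‖ + ‖g‖ * ‖g‖) - ‖f + g‖ ^ 2 := by
        linarith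
      rw [this]
      nlinarith
    have h4 : ‖f - g‖ = 0 := by
      by_contra hc
      have : 0 < ‖f - g‖ := lt_of_le_of_ne (norm_nonneg _) (Ne.symm hc)
      have : 0 < lam * (‖f - g‖ * ‖f - g‖) := by positivity
      linarith
    exact sub_eq_zero.1 (norm_eq_zero.1 h4)

theorem aux_condKernel {X Y : Type*} [MeasurableSpace X] [MeasurableSpace Y]
    (ρ : Measure (X × ℝ)) [IsProbabilityMeasure ρ]
    (ν : Measure (Y × ℝ)) [IsProbabilityMeasure ν]
    (e : Y → X) (he : MeasurableEmbedding e)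
    (h : ρ = ν.map (Prod.map e id)) :
    ∀ᵐ u ∂ν.fst, ρ.condKernel (e u) = ν.condKernel u := by
  have hE : MeasurableEmbedding (Prod.map e (id : ℝ → ℝ)) :=
    he.prodMap MeasurableEmbedding.id
  have hfst : ρ.fst = ν.fst.map e := by
    rw [h, Measure.fst, Measure.fst, Measure.map_map measurable_fst hE.measurable,
      Measure.map_map he.measurable measurable_fst]
    rfl
  have := eq_condKernel_of_measure_eq_compProd (ρ := ν)
    (ρ.condKernel.comap e he.measurable) ?_
  · simpa [Kernel.comap_apply] using this
  · ext s hs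
    have hs' := hE.measurableSet_image.2 hs
    rw [Measure.compProd_apply hs]
    have h1 : ν s = ρ (Prod.map e id '' s) := by
      rw [h, hE.map_apply, Set.preimage_image_eq _ hE.injective]
    rw [h1]
    conv_lhs => rw [← ρ.disintegrate ρ.condKernel]
    rw [Measure.compProd_apply hs', hfst, he.lintegral_map]
    refine lintegral_congr fun u => ?_
    rw [Kernel.comap_apply]
    congr 1
    ext y
    constructor
    · rintro ⟨⟨a, b⟩, hab, heq⟩
      simp only [Prod.map_apply, id, Prod.mk.injEq] at heq
      obtain ⟨h1, rfl⟩ := heq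
      rw [← he.injective h1]
      exact hab
    · intro hy
      exact ⟨(u, y), hy, rfl⟩

end aux

/-- **invariance of the approximation error under orthonormal reduction.**
For a radial kernel, an orthonormal-row matrix `A` invertible on the support of `ρ_X`, and
`ρ̃` the law of `(A X, Y)`: for every `λ > 0` the regularized approximation errors coincide,
`∫ (f_{λ,ρ} - f_ρ)² dρ_X = ∫ (f_{λ,ρ̃} - f_ρ̃)² dρ̃_X̃`; in particular the approximation
parameter `β` can be chosen equally for the learning problems with `ρ` and `ρ̃`. -/
theorem approximation_error_invariant_under_orthonormal_reduction
    (D d : ℕ) (M : ℝ) (hM : 0 < M)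
    (φ : ℝ → ℝ) (hφ0 : φ 0 = 1)
    (ρ : Measure (EuclideanSpace ℝ (Fin D) × ℝ)) [IsProbabilityMeasure ρ]
    (hY : ∀ᵐ z ∂ρ, |z.2| ≤ M)
    (A : EuclideanSpace ℝ (Fin D) →L[ℝ] EuclideanSpace ℝ (Fin d))
    (Ainv : EuclideanSpace ℝ (Fin d) →L[ℝ] EuclideanSpace ℝ (Fin D))
    (hA : ∀ u : EuclideanSpace ℝ (Fin d), ‖(ContinuousLinearMap.adjoint A) u‖ = ‖u‖)
    (hAinv : ∀ u : EuclideanSpace ℝ (Fin d), ‖Ainv u‖ = ‖u‖)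
    (hinv : ∀ x ∈ measureSupport (ρ.map Prod.fst), Ainv (A x) = x)
    (ρt : Measure (EuclideanSpace ℝ (Fin d) × ℝ)) [IsProbabilityMeasure ρt]
    (hρt : ρt = ρ.map (fun z => (A z.1, z.2)))
    -- the RKHSs on `ℝ^D` and `ℝ^d` defined by the same radial kernel
    (HD : Type*) [NormedAddCommGroup HD] [InnerProductSpace ℝ HD] [CompleteSpace HD]
    (kD : EuclideanSpace ℝ (Fin D) → HD)
    (hkD : ∀ x y, ⟪kD x, kD y⟫ = φ ‖x - y‖)
    (hdenseD : (Submodule.span ℝ (Set.range kD)).topologicalClosure = ⊤)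
    (Hd : Type*) [NormedAddCommGroup Hd] [InnerProductSpace ℝ Hd] [CompleteSpace Hd]
    (kd : EuclideanSpace ℝ (Fin d) → Hd)
    (hkd : ∀ x y, ⟪kd x, kd y⟫ = φ ‖x - y‖)
    (hdensed : (Submodule.span ℝ (Set.range kd)).topologicalClosure = ⊤)
    -- the regression functions of `ρ` and `ρ̃`
    (fρ : EuclideanSpace ℝ (Fin D) → ℝ)
    (hfρ : ∀ᵐ x ∂(ρ.map Prod.fst), fρ x = ∫ y, y ∂(ρ.condKernel x))
    (fρt : EuclideanSpace ℝ (Fin d) → ℝ)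
    (hfρt : ∀ᵐ x ∂(ρt.map Prod.fst), fρt x = ∫ y, y ∂(ρt.condKernel x))
    -- the families of regularized population solutions `λ ↦ f_{λ,ρ}`, `λ ↦ f_{λ,ρ̃}`
    (fD : ℝ → HD)
    (hfD : ∀ lam : ℝ, 0 < lam → ∀ g : HD,
      (∫ z, (⟪fD lam, kD z.1⟫ - z.2) ^ 2 ∂ρ) + lam * ‖fD lam‖ ^ 2 ≤
      (∫ z, (⟪g, kD z.1⟫ - z.2) ^ 2 ∂ρ) + lam * ‖g‖ ^ 2)
    (fd : ℝ → Hd)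
    (hfd : ∀ lam : ℝ, 0 < lam → ∀ g : Hd,
      (∫ z, (⟪fd lam, kd z.1⟫ - z.2) ^ 2 ∂ρt) + lam * ‖fd lam‖ ^ 2 ≤
      (∫ z, (⟪g, kd z.1⟫ - z.2) ^ 2 ∂ρt) + lam * ‖g‖ ^ 2) :
    (∀ lam : ℝ, 0 < lam →
      (∫ x, (⟪fD lam, kD x⟫ - fρ x) ^ 2 ∂(ρ.map Prod.fst)) =
      ∫ xt, (⟪fd lam, kd xt⟫ - fρt xt) ^ 2 ∂(ρt.map Prod.fst)) ∧
    (∀ C β : ℝ, 0 < C →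
      ((∀ lam : ℝ, 0 < lam →
          (∫ x, (⟪fD lam, kD x⟫ - fρ x) ^ 2 ∂(ρ.map Prod.fst)) +
            lam * ‖fD lam‖ ^ 2 ≤ C * lam ^ β) ↔
       (∀ lam : ℝ, 0 < lam →
          (∫ xt, (⟪fd lam, kd xt⟫ - fρt xt) ^ 2 ∂(ρt.map Prod.fst)) +
            lam * ‖fd lam‖ ^ 2 ≤ C * lam ^ β))) := by
  have hae : ∀ᵐ x ∂(ρ.map Prod.fst), Ainv (A x) = x := by
    have h0 : (ρ.map Prod.fst).support ∈ ae (ρ.map Prod.fst) := Measure.support_mem_ae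
    filter_upwards [h0] with x hx
    refine hinv x ?_
    intro U hU
    exact ((Measure.mem_support_iff_forall x).1 hx U hU).ne'
  have hAi : Isometry Ainv := AddMonoidHomClass.isometry_of_norm Ainv hAinv
  have hemb : MeasurableEmbedding Ainv := hAi.isClosedEmbedding.measurableEmbedding
  have hE : MeasurableEmbedding (Prod.map Ainv (id : ℝ → ℝ)) :=
    hemb.prodMap MeasurableEmbedding.id
  have hmA : Measurable (fun z : EuclideanSpace ℝ (Fin D) × ℝ => (A z.1, z.2)) := by
    have := A.continuous
    fun_prop
  have hρ : ρ = ρt.map (Prod.map Ainv id) := by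
    rw [hρt, Measure.map_map hE.measurable hmA]
    have : (Prod.map Ainv id ∘ fun z : EuclideanSpace ℝ (Fin D) × ℝ => (A z.1, z.2)) =ᵐ[ρ] id := by
      have h1 := ae_of_ae_map measurable_fst.aemeasurable hae
      filter_upwards [h1] with z hz
      simp [hz]
    rw [Measure.map_congr this, Measure.map_id]
  have hfst : ρ.map Prod.fst = (ρt.map Prod.fst).map Ainv := by
    conv_lhs => rw [hρ]
    rw [Measure.map_map measurable_fst hE.measurable,
      Measure.map_map hemb.measurable measurable_fst]
    rfl
  obtain ⟨J, hJ⟩ := aux_isometry kd (fun u => kD (Ainv u)) (by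
    intro u v
    rw [hkd, hkD, ← map_sub, hAinv]) hdensed
  set P := ContinuousLinearMap.adjoint J.toContinuousLinearMap with hP
  have hPk : ∀ (g : HD) u, ⟪g, kD (Ainv u)⟫ = ⟪P g, kd u⟫ := by
    intro g u
    rw [hP, ContinuousLinearMap.adjoint_inner_left]
    simp [hJ]
  have hPJ : ∀ h, P (J h) = h := by
    intro h
    refine ext_inner_right ℝ fun v => ?_
    rw [hP, ContinuousLinearMap.adjoint_inner_left]
    simp
  have hPn : ∀ g, ‖P g‖ ≤ ‖g‖ := by
    intro g
    have h1 : ‖P g‖ * ‖P g‖ ≤ ‖g‖ * ‖P g‖ := by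
      rw [← real_inner_self_eq_norm_mul_norm]
      conv_lhs => rw [hP, ContinuousLinearMap.adjoint_inner_left]
      refine (real_inner_le_norm _ _).trans ?_
      rw [← hP]
      simp
    rcases (norm_nonneg (P g)).eq_or_lt with h0 | h0
    · rw [← h0]; exact norm_nonneg _
    · exact le_of_mul_le_mul_right h1 h0
  have hloss : ∀ g : HD, ∫ z, (⟪g, kD z.1⟫ - z.2) ^ 2 ∂ρ =
      ∫ z, (⟪P g, kd z.1⟫ - z.2) ^ 2 ∂ρt := by
    intro g
    conv_lhs => rw [hρ]
    rw [hE.integral_map]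
    simp [hPk]
  have hYt : ∀ᵐ z ∂ρt, |z.2| ≤ M := by
    rw [hρt, ae_map_iff hmA.aemeasurable (measurableSet_le (by fun_prop) (by fun_prop))]
    exact hY
  have hy2 : Integrable (fun z : EuclideanSpace ℝ (Fin d) × ℝ => z.2 ^ 2) ρt := by
    refine Integrable.of_bound (by fun_prop) (M ^ 2) ?_
    filter_upwards [hYt] with z hz
    rw [Real.norm_eq_abs, abs_pow]
    exact pow_le_pow_left₀ (abs_nonneg _) hz 2
  have hsol : ∀ lam, 0 < lam → P (fD lam) = fd lam := by
    intro lam hl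
    refine aux_unique ρt kd hy2 lam hl _ _ (fun h => ?_) (hfd lam hl)
    have h1 := hfD lam hl (J h)
    rw [hloss, hloss, hPJ, J.norm_map] at h1
    have h2 : ‖P (fD lam)‖ ^ 2 ≤ ‖fD lam‖ ^ 2 := pow_le_pow_left₀ (norm_nonneg _) (hPn _) 2
    nlinarith
  have hnorm : ∀ lam, 0 < lam → ‖fD lam‖ = ‖fd lam‖ := by
    intro lam hl
    refine le_antisymm ?_ (by rw [← hsol lam hl]; exact hPn _)
    have h1 := hfD lam hl (J (fd lam))
    rw [hloss, hloss, hPJ, J.norm_map, hsol lam hl] at h1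
    have h2 : ‖fD lam‖ ^ 2 ≤ ‖fd lam‖ ^ 2 := le_of_mul_le_mul_left (by linarith) hl
    exact (pow_le_pow_iff_left₀ (norm_nonneg _) (norm_nonneg _) two_ne_zero).1 h2
  have hreg : ∀ᵐ u ∂(ρt.map Prod.fst), fρ (Ainv u) = fρt u := by
    have h1 : ∀ᵐ u ∂(ρt.map Prod.fst), ρ.condKernel (Ainv u) = ρt.condKernel u :=
      aux_condKernel ρ ρt Ainv hemb hρ
    rw [hfst] at hfρ
    have h2 := ae_of_ae_map hemb.measurable.aemeasurable hfρ
    filter_upwards [h1, h2, hfρt] with u a b c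
    rw [b, c, a]
  have hmain : ∀ lam : ℝ, 0 < lam →
      (∫ x, (⟪fD lam, kD x⟫ - fρ x) ^ 2 ∂(ρ.map Prod.fst)) =
      ∫ xt, (⟪fd lam, kd xt⟫ - fρt xt) ^ 2 ∂(ρt.map Prod.fst) := by
    intro lam hl
    rw [hfst, hemb.integral_map]
    refine integral_congr_ae ?_
    filter_upwards [hreg] with u hu
    rw [hPk, hsol lam hl, hu]
  refine ⟨hmain, fun C β _ => forall_congr' fun lam => forall_congr' fun hl => ?_⟩
  rw [hmain lam hl, hnorm lam hl]
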